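/- For every integer k ≥ 3: (i) every set of 2k − 3 points in the plane in general position contains k points in convex position or 5 points forming a 5-pseudo-triangle; and (ii) there exists a set of 2k − 4 points in general position containing neither k points in convex position nor a 5-pseudo-triangle. In other words, F(k,5) = 2k − 3. -/

import Mathlib

open Set

noncomputable section

/-- Points of the plane. -/
abbrev Pt : Type := ℝ × ℝ

/-- Two-dimensional cross product. -/
def cross2 (u w : Pt) : ℝ := u.1 * w.2 - u.2 * w.1

/-- A set of points is in general position if no three of its points are collinear. -/
def GenPos (S : Set Pt) : Prop :=
  ∀ p ∈ S, ∀ q ∈ S, ∀ r ∈ S, p ≠ q → p ≠ r → q ≠ r →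
    ¬ Collinear ℝ ({p, q, r} : Set Pt)

/-- `v : ZMod n → Pt` lists the vertices (in cyclic order) of a simple polygon:
vertices are pairwise distinct, non-adjacent edges are disjoint, and adjacent
edges meet exactly in their common vertex. -/
structure IsSimplePolygon (n : ℕ) (v : ZMod n → Pt) : Prop where
  three_le : 3 ≤ n
  inj : Function.Injective v
  nonadj : ∀ i j : ZMod n, i ≠ j → i ≠ j + 1 → j ≠ i + 1 →
    segment ℝ (v i) (v (i + 1)) ∩ segment ℝ (v j) (v (j + 1)) = ∅
  adj : ∀ i : ZMod n,
    segment ℝ (v i) (v (i + 1)) ∩ segment ℝ (v (i + 1)) (v (i + 2)) = {v (i + 1)}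

/-- Twice the signed area of a polygon. -/
def signedArea (n : ℕ) (v : ZMod n → Pt) : ℝ :=
  if h : n = 0 then 0 else
    haveI : NeZero n := ⟨h⟩
    ∑ i : ZMod n, cross2 (v i) (v (i + 1))

/-- The turning cross product at vertex `i`. -/
def vtxCross (n : ℕ) (v : ZMod n → Pt) (i : ZMod n) : ℝ :=
  cross2 (v i - v (i - 1)) (v (i + 1) - v i)

/-- Vertex `i` of a simple polygon is convex (interior angle `< π`) iff the turn
at `i` has the same (strict) sign as the orientation of the polygon. -/
def IsConvexVtx (n : ℕ) (v : ZMod n → Pt) (i : ZMod n) : Prop :=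
  0 < vtxCross n v i * signedArea n v

/-- A pseudo-triangle: a simple polygon in which every vertex is strictly convex or
strictly reflex, with exactly three convex vertices. -/
def IsPseudoTriangle (n : ℕ) (v : ZMod n → Pt) : Prop :=
  IsSimplePolygon n v ∧ (∀ i : ZMod n, vtxCross n v i ≠ 0) ∧
    {i : ZMod n | IsConvexVtx n v i}.ncard = 3

/-- A standard pseudo-triangle: each of the three side chains has at least two
edges, i.e. no two convex vertices are cyclically adjacent. -/
def IsStandardPseudoTriangle (n : ℕ) (v : ZMod n → Pt) : Prop :=
  IsPseudoTriangle n v ∧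
    ∀ i : ZMod n, IsConvexVtx n v i → ¬ IsConvexVtx n v (i + 1)

/-- A mountain: a pseudo-triangle in which exactly one side chain consists of a
single edge (i.e. exactly one cyclically adjacent pair of convex vertices);
a 3-mountain is a triangle. -/
def IsMountain (n : ℕ) (v : ZMod n → Pt) : Prop :=
  IsPseudoTriangle n v ∧
    (n = 3 ∨ {i : ZMod n | IsConvexVtx n v i ∧ IsConvexVtx n v (i + 1)}.ncard = 1)

/-- The boundary of a polygon: the union of its edges. -/
def polyBoundary (n : ℕ) (v : ZMod n → Pt) : Set Pt :=
  ⋃ i : ZMod n, segment ℝ (v i) (v (i + 1))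

/-- The interior of a simple polygon: the union of the bounded connected
components of the complement of its boundary. -/
def polyInterior (n : ℕ) (v : ZMod n → Pt) : Set Pt :=
  {x : Pt | x ∉ polyBoundary n v ∧
    Bornology.IsBounded (connectedComponentIn (polyBoundary n v)ᶜ x)}

/-- A polygon is empty in `S` if its interior contains no point of `S`. -/
def EmptyIn (n : ℕ) (v : ZMod n → Pt) (S : Set Pt) : Prop :=
  polyInterior n v ∩ S = ∅

/-- `S` contains an empty `ℓ`-pseudo-triangle. -/
def HasEmptyPseudoTriangle (ℓ : ℕ) (S : Set Pt) : Prop :=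
  ∃ v : ZMod ℓ → Pt, Set.range v ⊆ S ∧ IsPseudoTriangle ℓ v ∧ EmptyIn ℓ v S

/-- A set of points is in convex position if each of them is a vertex of their
convex hull. -/
def ConvexPos (H : Set Pt) : Prop := ∀ p ∈ H, p ∉ convexHull ℝ (H \ {p})

/-- `H` is a `k`-hole in `S`: `k` points of `S` in convex position whose convex
hull contains no other point of `S` in its interior. -/
def IsHole (k : ℕ) (S H : Set Pt) : Prop :=
  H ⊆ S ∧ H.ncard = k ∧ ConvexPos H ∧
    ∀ p ∈ S, p ∈ interior (convexHull ℝ H) → p ∈ H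

/-- `S` contains a `k`-hole. -/
def HasHole (k : ℕ) (S : Set Pt) : Prop := ∃ H : Set Pt, IsHole k S H

/-- The points of `S` that are vertices of the convex hull of `S`. -/
def hullVertices (S : Set Pt) : Set Pt := {p ∈ S | p ∉ convexHull ℝ (S \ {p})}

/-- The points of `S` lying in the interior of the convex hull of `S`. -/
def interiorPts (S : Set Pt) : Set Pt := {p ∈ S | p ∈ interior (convexHull ℝ S)}

/-- `S` is `λ`-convex: every triangle with vertices in `S` contains at most `λ`
points of `S` in its interior. -/
def LambdaConvex (lam : ℕ) (S : Set Pt) : Prop :=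
  ∀ p ∈ S, ∀ q ∈ S, ∀ r ∈ S,
    (S ∩ interior (convexHull ℝ ({p, q, r} : Set Pt))).ncard ≤ lam

/-- Orientation of a triple of points. -/
def ori (p q r : Pt) : ℝ := (q.1 - p.1) * (r.2 - p.2) - (q.2 - p.2) * (r.1 - p.1)

lemma ori_rot (p q r : Pt) : ori p q r = ori q r p := by unfold ori; ring
lemma ori_swap (p q r : Pt) : ori p q r = - ori q p r := by unfold ori; ring
lemma ori_swap2 (p q r : Pt) : ori p q r = - ori p r q := by unfold ori; ring

lemma ori_combo (p q A B : Pt) (s t : ℝ) (h : s + t = 1) :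
    ori p q (s • A + t • B) = s * ori p q A + t * ori p q B := by
  have : s = 1 - t := by linarith
  subst this
  simp only [ori, Prod.fst_add, Prod.snd_add, Prod.smul_fst, Prod.smul_snd, smul_eq_mul]
  ring

lemma ori_ne_of_genPos {S : Set Pt} (hS : GenPos S) {p q r : Pt} (hp : p ∈ S) (hq : q ∈ S)
    (hr : r ∈ S) (h1 : p ≠ q) (h2 : p ≠ r) (h3 : q ≠ r) : ori p q r ≠ 0 := by
  intro h
  apply hS p hp q hq r hr h1 h2 h3
  rw [collinear_iff_of_mem (p₀ := p) (by simp)]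
  refine ⟨q - p, ?_⟩
  intro z hz
  simp only [Set.mem_insert_iff, Set.mem_singleton_iff] at hz
  rcases hz with rfl | rfl | rfl
  · exact ⟨0, by simp⟩
  · exact ⟨1, by simp⟩
  · unfold ori at h
    by_cases hx : q.1 - p.1 = 0
    · have hy : q.2 - p.2 ≠ 0 := by
        intro hy
        exact h1 (Prod.ext (by linarith) (by linarith))
      refine ⟨(z.2 - p.2) / (q.2 - p.2), ?_⟩
      rw [hx] at h
      have h4 : z.1 - p.1 = 0 := by
        have : (q.2 - p.2) * (z.1 - p.1) = 0 := by linarith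
        exact (mul_eq_zero.mp this).resolve_left hy
      ext
      · simp [hx]; linarith
      · simp; field_simp; ring
    · refine ⟨(z.1 - p.1) / (q.1 - p.1), ?_⟩
      ext
      · simp; field_simp; ring
      · simp; field_simp; linarith

lemma not_collinear_of_ori {p q r : Pt} (h : ori p q r ≠ 0) :
    ¬ Collinear ℝ ({p, q, r} : Set Pt) := by
  intro hc
  rw [collinear_iff_of_mem (p₀ := p) (by simp)] at hc
  obtain ⟨v, hv⟩ := hc
  obtain ⟨s, hs⟩ := hv q (by simp)
  obtain ⟨t, ht⟩ := hv r (by simp)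
  apply h
  subst hs ht
  simp [ori]
  ring

lemma seg_disjoint {A B C D : Pt} (h : 0 < ori A B C * ori A B D) :
    segment ℝ A B ∩ segment ℝ C D = ∅ := by
  rw [Set.eq_empty_iff_forall_notMem]
  rintro z ⟨⟨a, b, ha, hb, hab, rfl⟩, ⟨c, d, hc, hd, hcd, h2⟩⟩
  have e1 := ori_combo A B A B a b hab
  have e2 := ori_combo A B C D c d hcd
  have e3 : ori A B A = 0 := by simp [ori]
  have e4 : ori A B B = 0 := by unfold ori; ring
  rw [← h2, e3, e4, e2] at e1
  rcases pos_and_pos_or_neg_and_neg_of_mul_pos h with ⟨h5, h6⟩ | ⟨h5, h6⟩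
  · rcases hc.eq_or_lt with rfl | hc'
    · have : d = 1 := by linarith
      subst this; linarith
    · nlinarith [mul_pos hc' h5, mul_nonneg hd h6.le]
  · rcases hc.eq_or_lt with rfl | hc'
    · have : d = 1 := by linarith
      subst this; linarith
    · nlinarith [mul_neg_of_pos_of_neg hc' h5, mul_nonneg hd (neg_pos.2 h6).le]

lemma seg_adj {A B C : Pt} (h : ori A B C ≠ 0) :
    segment ℝ A B ∩ segment ℝ B C = {B} := by
  apply Set.eq_singleton_iff_unique_mem.2
  refine ⟨⟨right_mem_segment _ _ _, left_mem_segment _ _ _⟩, ?_⟩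
  rintro z ⟨⟨a, b, ha, hb, hab, rfl⟩, ⟨c, d, hc, hd, hcd, h2⟩⟩
  have e1 := ori_combo A B A B a b hab
  have e2 := ori_combo A B B C c d hcd
  have e3 : ori A B A = 0 := by simp [ori]
  have e4 : ori A B B = 0 := by unfold ori; ring
  rw [← h2, e3, e4, e2, e4] at e1
  have : d = 0 := by
    have : d * ori A B C = 0 := by linarith
    exact (mul_eq_zero.mp this).resolve_right h
  subst this
  have : c = 1 := by linarith
  subst this
  rw [← h2]; simp

/-- Properly crossing segments meet. -/
lemma seg_cross {A B C D : Pt} (h1 : ori A B C * ori A B D < 0) (h2 : ori C D A * ori C D B < 0) :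
    (segment ℝ A B ∩ segment ℝ C D).Nonempty := by
  set x := ori A B C with hx
  set y := ori A B D with hy
  set u := ori C D A with hu
  set w := ori C D B with hw
  have hxy : x - y ≠ 0 := by intro h; have : x = y := by linarith
                             rw [this] at h1; nlinarith
  have huw : u - w ≠ 0 := by intro h; have : u = w := by linarith
                             rw [this] at h2; nlinarith
  have key : ∀ s t : ℝ, s * t < 0 → s - t ≠ 0 → 0 ≤ s / (s - t) ∧ 0 ≤ - t / (s - t) := by
    intro s t hst hne
    rcases mul_neg_iff.1 hst with ⟨h, h'⟩ | ⟨h, h'⟩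
    · exact ⟨div_nonneg h.le (by linarith), div_nonneg (by linarith) (by linarith)⟩
    · exact ⟨div_nonneg_of_nonpos h.le (by linarith), div_nonneg_of_nonpos (by linarith) (by linarith)⟩
  obtain ⟨k1, k2⟩ := key x y h1 hxy
  obtain ⟨k3, k4⟩ := key u w h2 huw
  refine ⟨(- w / (u - w)) • A + (u / (u - w)) • B, ⟨_, _, k4, k3, by field_simp; ring, rfl⟩,
    ⟨-y / (x - y), x / (x - y), k2, k1, by field_simp; ring, ?_⟩⟩
  have h7 : u - w = y - x := by simp only [hx, hy, hu, hw, ori]; ring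
  have h8 : u - w = -(x - y) := by linarith
  rw [h8]
  ext
  · simp only [Prod.fst_add, Prod.smul_fst, smul_eq_mul]
    field_simp
    simp only [hx, hy, hu, hw, ori]; ring
  · simp only [Prod.snd_add, Prod.smul_snd, smul_eq_mul]
    field_simp
    simp only [hx, hy, hu, hw, ori]; ring

lemma mem_hull_triangle {a b c p : Pt} (h1 : 0 ≤ ori p b c) (h2 : 0 ≤ ori a p c)
    (h3 : 0 ≤ ori a b p) (h : 0 < ori a b c) : p ∈ convexHull ℝ ({a, b, c} : Set Pt) := by
  have hs : ori p b c + ori a p c + ori a b p = ori a b c := by unfold ori; ring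
  have hc : Convex ℝ (convexHull ℝ ({a, b, c} : Set Pt)) := convex_convexHull _ _
  have hsub := subset_convexHull ℝ ({a, b, c} : Set Pt)
  have ha : a ∈ convexHull ℝ ({a, b, c} : Set Pt) := hsub (by simp)
  have hb : b ∈ convexHull ℝ ({a, b, c} : Set Pt) := hsub (by simp)
  have hcc : c ∈ convexHull ℝ ({a, b, c} : Set Pt) := hsub (by simp)
  have hw : ∑ i : Fin 3, (![ori p b c / ori a b c, ori a p c / ori a b c, ori a b p / ori a b c] i)
      • (![a, b, c] i : Pt) ∈ convexHull ℝ ({a, b, c} : Set Pt) := by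
    apply hc.sum_mem
    · intro i _
      fin_cases i
      · exact div_nonneg h1 h.le
      · exact div_nonneg h2 h.le
      · exact div_nonneg h3 h.le
    · simp [Fin.sum_univ_three]
      field_simp
      exact hs
    · intro i _
      fin_cases i <;> assumption
  convert hw
  simp only [Fin.sum_univ_three, Matrix.cons_val]
  have hne := h.ne'
  ext
  · simp only [Prod.fst_add, Prod.smul_fst, smul_eq_mul]
    field_simp
    simp only [ori]; ring
  · simp only [Prod.snd_add, Prod.smul_snd, smul_eq_mul]
    field_simp
    simp only [ori]; ring

lemma vtxCross_eq (n : ℕ) (v : ZMod n → Pt) (i : ZMod n) :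
    vtxCross n v i = ori (v (i - 1)) (v i) (v (i + 1)) := by
  simp [vtxCross, cross2, ori]; ring

lemma zmod5_cases {P : ZMod 5 → Prop} (h0 : P 0) (h1 : P 1) (h2 : P 2) (h3 : P 3) (h4 : P 4) :
    ∀ i, P i := by
  intro i
  have : i = 0 ∨ i = 1 ∨ i = 2 ∨ i = 3 ∨ i = 4 := by revert i; decide
  rcases this with rfl | rfl | rfl | rfl | rfl <;> assumption

lemma signedArea_five (v : ZMod 5 → Pt) : signedArea 5 v =
    cross2 (v 0) (v 1) + cross2 (v 1) (v 2) + cross2 (v 2) (v 3) + cross2 (v 3) (v 4)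
      + cross2 (v 4) (v 0) := by
  simp only [signedArea]
  rw [dif_neg (by norm_num)]
  have := Fin.sum_univ_five (fun i : ZMod 5 => cross2 (v i) (v (i + 1)))
  exact this

/-- The explicit pentagon. -/
lemma pentagon {p q r a b : Pt} (hb1 : 0 < ori p q b) (hb2 : 0 < ori q r b) (hb3 : 0 < ori r p b)
    (ha1 : 0 < ori p q a) (ha2 : 0 < ori q r a) (ha3 : 0 < ori r p a)
    (hr : 0 < ori a b r) (hp : ori a b p < 0) (hq : ori a b q < 0) :
    ∃ v : ZMod 5 → Pt, Set.range v ⊆ {p, q, b, r, a} ∧ IsPseudoTriangle 5 v := by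
  have hpqr : 0 < ori p q r := by
    have : ori p q r = ori p q a + ori q r a + ori r p a := by unfold ori; ring
    linarith
  let v : ZMod 5 → Pt := ![p, q, b, r, a]
  have v0 : v 0 = p := rfl
  have v1 : v 1 = q := rfl
  have v2 : v 2 = b := rfl
  have v3 : v 3 = r := rfl
  have v4 : v 4 = a := rfl
  have t0 : vtxCross 5 v 0 = ori p q a := by
    rw [vtxCross_eq, ori_rot]; rfl
  have t1 : vtxCross 5 v 1 = ori p q b := by
    rw [vtxCross_eq]; rfl
  have t2 : vtxCross 5 v 2 = - ori q r b := by
    rw [vtxCross_eq, ← ori_swap2]; rfl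
  have t3 : vtxCross 5 v 3 = ori a b r := by
    rw [vtxCross_eq, ori_rot a b r]; rfl
  have t4 : vtxCross 5 v 4 = - ori r p a := by
    rw [vtxCross_eq, ← ori_swap2]; rfl
  have area : 0 < signedArea 5 v := by
    have e : signedArea 5 v = ori p q b + (ori a b r - ori a b p) := by
      rw [signedArea_five, v0, v1, v2, v3, v4]
      simp only [cross2, ori]; ring
    rw [e]; linarith
  have hall : ∀ i : ZMod 5, vtxCross 5 v i ≠ 0 := by
    intro i
    change Fin 5 at i
    fin_cases i
    · exact t0.trans_ne ha1.ne'
    · exact t1.trans_ne hb1.ne'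
    · exact t2.trans_ne (neg_ne_zero.2 hb2.ne')
    · exact t3.trans_ne hr.ne'
    · exact t4.trans_ne (neg_ne_zero.2 ha3.ne')
  have ne_of : ∀ {A B C : Pt}, ori A B C ≠ 0 → A ≠ B ∧ A ≠ C ∧ B ≠ C := by
    intro A B C h
    refine ⟨?_, ?_, ?_⟩ <;> rintro rfl <;> apply h <;> unfold ori <;> ring
  refine ⟨v, ?_, ⟨by norm_num, ?_, ?_, ?_⟩, hall, ?_⟩
  · rintro _ ⟨i, rfl⟩
    change Fin 5 at i
    fin_cases i
    · change p ∈ _; simp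
    · change q ∈ _; simp
    · change b ∈ _; simp
    · change r ∈ _; simp
    · change a ∈ _; simp
  · obtain ⟨n1, n2, n3⟩ := ne_of hb1.ne'
    obtain ⟨n4, n5, n6⟩ := ne_of ha1.ne'
    obtain ⟨m1, m2, m3⟩ := ne_of hb2.ne'
    obtain ⟨m4, m5, m6⟩ := ne_of ha3.ne'
    obtain ⟨o1, o2, o3⟩ := ne_of hr.ne'
    have : Function.Injective (![p, q, b, r, a] : Fin 5 → Pt) := by
      intro i j hij
      fin_cases i <;> fin_cases j <;> first | rfl | (exfalso; revert hij; simp; tauto)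
    exact this
  · have d1 : segment ℝ p q ∩ segment ℝ b r = ∅ := seg_disjoint (mul_pos hb1 hpqr)
    have d2 : segment ℝ p q ∩ segment ℝ r a = ∅ := seg_disjoint (mul_pos hpqr ha1)
    have d3 : segment ℝ r a ∩ segment ℝ q b = ∅ :=
      seg_disjoint (mul_pos (by rwa [ori_rot q r a] at ha2)
        (by rwa [ori_rot]))
    have d4 : segment ℝ b r ∩ segment ℝ a p = ∅ := by
      apply seg_disjoint
      have : ori b r p = ori r p b := by rw [ori_rot]
      rw [this, ← ori_rot]
      exact mul_pos hr hb3
    have d5 : segment ℝ q b ∩ segment ℝ a p = ∅ := by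
      apply seg_disjoint
      rw [← ori_rot p q b, ori_rot q b a, ori_swap b a q]
      exact mul_pos (by linarith) hb1
    have D : ∀ i j : ZMod 5, i ≠ j → i ≠ j + 1 → j ≠ i + 1 →
        segment ℝ (v i) (v (i + 1)) ∩ segment ℝ (v j) (v (j + 1)) = ∅ := by
      refine zmod5_cases ?_ ?_ ?_ ?_ ?_ <;> refine zmod5_cases ?_ ?_ ?_ ?_ ?_ <;>
        intro h1 h2 h3 <;>
        first
        | exact absurd rfl h1
        | exact absurd rfl h2
        | exact absurd rfl h3
        | exact d1
        | exact d2
        | exact d3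
        | exact d4
        | exact d5
        | exact (Set.inter_comm _ _).trans d1
        | exact (Set.inter_comm _ _).trans d2
        | exact (Set.inter_comm _ _).trans d3
        | exact (Set.inter_comm _ _).trans d4
        | exact (Set.inter_comm _ _).trans d5
    exact D
  · intro i
    have := hall (i + 1)
    rw [vtxCross_eq] at this
    have e1 : i + 1 - 1 = i := by ring
    have e2 : i + 1 + 1 = i + 2 := by ring
    rw [e1, e2] at this
    exact seg_adj this
  · have : {i : ZMod 5 | IsConvexVtx 5 v i} = (({0, 1, 3} : Finset (ZMod 5)) : Set (ZMod 5)) := by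
      ext i
      rw [Finset.mem_coe]
      change 0 < vtxCross 5 v i * signedArea 5 v ↔ _
      rw [mul_pos_iff_of_pos_right area]
      revert i
      refine zmod5_cases ?_ ?_ ?_ ?_ ?_
      · exact iff_of_true (by rwa [t0]) (by decide)
      · exact iff_of_true (by rwa [t1]) (by decide)
      · exact iff_of_false (by rw [t2]; linarith) (by decide)
      · exact iff_of_true (by rwa [t3]) (by decide)
      · exact iff_of_false (by rw [t4]; linarith) (by decide)
    rw [this, Set.ncard_coe_finset]
    rfl

lemma pentagon_of_two {S : Set Pt} (hS : GenPos S) {p q r a b : Pt}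
    (mp : p ∈ S) (mq : q ∈ S) (mr : r ∈ S) (ma : a ∈ S) (mb : b ∈ S) (hab : a ≠ b)
    (hb1 : 0 < ori p q b) (hb2 : 0 < ori q r b) (hb3 : 0 < ori r p b)
    (ha1 : 0 < ori p q a) (ha2 : 0 < ori q r a) (ha3 : 0 < ori r p a) :
    ∃ v : ZMod 5 → Pt, Set.range v ⊆ S ∧ IsPseudoTriangle 5 v := by
  have ne_of : ∀ {A B C : Pt}, 0 < ori A B C → A ≠ B ∧ A ≠ C ∧ B ≠ C := by
    intro A B C h
    refine ⟨?_, ?_, ?_⟩ <;> rintro rfl <;> apply h.ne' <;> unfold ori <;> ring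
  have np := ori_ne_of_genPos hS ma mb mp hab (ne_of ha1).2.1.symm (ne_of hb1).2.1.symm
  have nq := ori_ne_of_genPos hS ma mb mq hab (ne_of ha1).2.2.symm (ne_of hb1).2.2.symm
  have nr := ori_ne_of_genPos hS ma mb mr hab (ne_of ha2).2.2.symm (ne_of hb2).2.2.symm
  have hz : ori q r a * ori a b p + ori r p a * ori a b q + ori p q a * ori a b r = 0 := by
    unfold ori; ring
  have sw : ∀ z, ori b a z = - ori a b z := fun z => ori_swap b a z
  have fin : ∀ x1 x2 x3 x4 x5 : Pt, x1 ∈ S → x2 ∈ S → x3 ∈ S → x4 ∈ S → x5 ∈ S →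
      (∃ v : ZMod 5 → Pt, Set.range v ⊆ {x1, x2, x3, x4, x5} ∧ IsPseudoTriangle 5 v) →
      ∃ v : ZMod 5 → Pt, Set.range v ⊆ S ∧ IsPseudoTriangle 5 v := by
    rintro x1 x2 x3 x4 x5 h1 h2 h3 h4 h5 ⟨v, hv, hv'⟩
    refine ⟨v, hv.trans ?_, hv'⟩
    intro z hz
    simp only [Set.mem_insert_iff, Set.mem_singleton_iff] at hz
    rcases hz with rfl | rfl | rfl | rfl | rfl <;> assumption
  rcases lt_or_gt_of_ne np with hp | hp <;> rcases lt_or_gt_of_ne nq with hq | hq <;>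
    rcases lt_or_gt_of_ne nr with hr | hr
  · nlinarith [mul_pos ha2 (neg_pos.2 hp), mul_pos ha3 (neg_pos.2 hq), mul_pos ha1 (neg_pos.2 hr)]
  · exact fin _ _ _ _ _ mp mq mb mr ma (pentagon hb1 hb2 hb3 ha1 ha2 ha3 hr hp hq)
  · exact fin _ _ _ _ _ mr mp mb mq ma (pentagon hb3 hb1 hb2 ha3 ha1 ha2 hq hr hp)
  · exact fin _ _ _ _ _ mq mr ma mp mb (pentagon ha2 ha3 ha1 hb2 hb3 hb1
      (by rw [sw]; linarith) (by rw [sw]; linarith) (by rw [sw]; linarith))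
  · exact fin _ _ _ _ _ mq mr mb mp ma (pentagon hb2 hb3 hb1 ha2 ha3 ha1 hp hq hr)
  · exact fin _ _ _ _ _ mr mp ma mq mb (pentagon ha3 ha1 ha2 hb3 hb1 hb2
      (by rw [sw]; linarith) (by rw [sw]; linarith) (by rw [sw]; linarith))
  · exact fin _ _ _ _ _ mp mq ma mr mb (pentagon ha1 ha2 ha3 hb1 hb2 hb3
      (by rw [sw]; linarith) (by rw [sw]; linarith) (by rw [sw]; linarith))
  · nlinarith [mul_pos ha2 hp, mul_pos ha3 hq, mul_pos ha1 hr]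

/-- A linear functional separating a point from a finite hull. -/
lemma exists_sep {T : Set Pt} (hT : T.Finite) {v : Pt} (hv : v ∉ convexHull ℝ T) :
    ∃ a b : ℝ, ∀ w ∈ T, 0 < a * (w.1 - v.1) + b * (w.2 - v.2) := by
  have hcl : IsClosed (convexHull ℝ T) := hT.isClosed_convexHull _
  obtain ⟨f, u, hf, hu⟩ := geometric_hahn_banach_point_closed (convex_convexHull ℝ T) hcl hv
  refine ⟨f (1, 0), f (0, 1), fun w hw => ?_⟩
  have h1 := hu w (subset_convexHull ℝ T hw)
  have e : ∀ z : Pt, f z = f (1, 0) * z.1 + f (0, 1) * z.2 := by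
    intro z
    have : z = z.1 • ((1, 0) : Pt) + z.2 • ((0, 1) : Pt) := by ext <;> simp
    conv_lhs => rw [this]
    rw [map_add, map_smul, map_smul]
    simp [mul_comm]
  rw [e] at hf h1
  linarith

lemma halfplane_convex (a b c : ℝ) : Convex ℝ {z : Pt | c ≤ a * z.1 + b * z.2} := by
  intro x hx y hy s t hs ht hst
  have hx' : c ≤ a * x.1 + b * x.2 := hx
  have hy' : c ≤ a * y.1 + b * y.2 := hy
  change c ≤ a * (s * x.1 + t * y.1) + b * (s * x.2 + t * y.2)
  have : c = s * c + t * c := by rw [← add_mul, hst, one_mul]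
  nlinarith [mul_le_mul_of_nonneg_left hx' hs, mul_le_mul_of_nonneg_left hy' ht]

lemma hull_halfplane {V : Set Pt} {a b c : ℝ} (h : ∀ z ∈ V, c ≤ a * z.1 + b * z.2) {x : Pt}
    (hx : x ∈ convexHull ℝ V) : c ≤ a * x.1 + b * x.2 :=
  convexHull_min (t := {z : Pt | c ≤ a * z.1 + b * z.2}) h (halfplane_convex a b c) hx

lemma hull_ori {V : Set Pt} {u w : Pt} (h : ∀ z ∈ V, 0 ≤ ori u w z) {x : Pt}
    (hx : x ∈ convexHull ℝ V) : 0 ≤ ori u w x := by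
  have := hull_halfplane (V := V) (a := -(w.2 - u.2)) (b := w.1 - u.1)
    (c := (w.1 - u.1) * u.2 - (w.2 - u.2) * u.1) (fun z hz => by
      have := h z hz
      unfold ori at this
      linarith) hx
  unfold ori
  linarith

/-- Main part of the upper bound. -/
lemma two_in_triangle {S : Set Pt} (hS : GenPos S) (V I : Finset Pt) (hVS : (V : Set Pt) ⊆ S)
    (hIS : (I : Set Pt) ⊆ S) (hdisj : ∀ x ∈ I, x ∉ V) (hV : ConvexPos (V : Set Pt))
    (hI : ∀ x ∈ I, x ∈ convexHull ℝ (V : Set Pt)) (hIne : I.Nonempty) (hcard : V.card ≤ I.card + 1) :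
    ∃ v : ZMod 5 → Pt, Set.range v ⊆ S ∧ IsPseudoTriangle 5 v := by
  obtain ⟨x0, hx0⟩ := hIne
  have hVne : V.Nonempty := by
    by_contra h
    rw [Finset.not_nonempty_iff_eq_empty] at h
    have := hI x0 hx0
    simp [h] at this
  obtain ⟨v, hv⟩ := hVne
  -- separate v
  obtain ⟨a, b, hab0⟩ := exists_sep (T := (V : Set Pt) \ {v}) (V.finite_toSet.subset Set.sdiff_subset)
    (hV v hv)
  set F : Pt → ℝ := fun w => a * (w.1 - v.1) + b * (w.2 - v.2) with hF
  set G : Pt → ℝ := fun w => -b * (w.1 - v.1) + a * (w.2 - v.2) with hG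
  set th : Pt → ℝ := fun w => G w / F w with hth
  set W := V.erase v with hW
  have hFW : ∀ w ∈ W, 0 < F w := by
    intro w hw
    rw [hW, Finset.mem_erase] at hw
    exact hab0 w ⟨hw.2, hw.1⟩
  have hWne : W.Nonempty := by
    by_contra h
    rw [Finset.not_nonempty_iff_eq_empty] at h
    have h2 : V = {v} := by rw [← Finset.insert_erase hv, ← hW, h]; rfl
    have := hI x0 hx0
    rw [h2] at this
    simp at this
    exact hdisj x0 hx0 (this ▸ hv)
  have hvF : F v = 0 := by simp [hF]
  have hvG : G v = 0 := by simp [hG]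
  -- bounds on the slopes
  have hFI0 : ∀ x ∈ I, 0 ≤ F x := by
    intro x hx
    have := hull_halfplane (V := V) (a := a) (b := b) (c := a * v.1 + b * v.2) (fun z hz => by
      by_cases hzv : z = v
      · rw [hzv]
      · have := hFW z (Finset.mem_erase.2 ⟨hzv, hz⟩)
        simp only [hF] at this
        linarith) (hI x hx)
    simp only [hF]; linarith
  have hupper : ∀ M : ℝ, (∀ w ∈ W, th w ≤ M) → ∀ x ∈ I, G x ≤ M * F x := by
    intro M hM x hx
    have := hull_halfplane (V := V) (a := M * a + b) (b := M * b - a)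
      (c := (M * a + b) * v.1 + (M * b - a) * v.2) (fun z hz => by
        by_cases hzv : z = v
        · rw [hzv]
        · have hzW : z ∈ W := Finset.mem_erase.2 ⟨hzv, hz⟩
          have := hM z hzW
          simp only [hth] at this
          rw [div_le_iff₀ (hFW z hzW)] at this
          simp only [hF, hG] at this
          linarith) (hI x hx)
    simp only [hF, hG]; linarith
  have hlower : ∀ M : ℝ, (∀ w ∈ W, M ≤ th w) → ∀ x ∈ I, M * F x ≤ G x := by
    intro M hM x hx
    have := hull_halfplane (V := V) (a := -(M * a + b)) (b := -(M * b - a))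
      (c := -(M * a + b) * v.1 + -(M * b - a) * v.2) (fun z hz => by
        by_cases hzv : z = v
        · rw [hzv]
        · have hzW : z ∈ W := Finset.mem_erase.2 ⟨hzv, hz⟩
          have := hM z hzW
          simp only [hth] at this
          rw [le_div_iff₀ (hFW z hzW)] at this
          simp only [hF, hG] at this
          linarith) (hI x hx)
    simp only [hF, hG]; linarith
  obtain ⟨wM, hwM, hwM'⟩ := W.exists_max_image th hWne
  obtain ⟨wm, hwm, hwm'⟩ := W.exists_min_image th hWne
  have hab : 0 < a ^ 2 + b ^ 2 := by
    by_contra h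
    have ha : a = 0 := by nlinarith [sq_nonneg a, sq_nonneg b]
    have hb : b = 0 := by nlinarith [sq_nonneg a, sq_nonneg b]
    have := hFW wM hwM
    simp [hF, ha, hb] at this
  have hne : ∀ x ∈ I, x ≠ v := fun x hx h => hdisj x hx (h ▸ hv)
  have hFI : ∀ x ∈ I, 0 < F x := by
    intro x hx
    rcases (hFI0 x hx).eq_or_lt with h | h
    · exfalso
      have h1 := hupper _ hwM' x hx
      have h2 := hlower _ hwm' x hx
      rw [← h] at h1 h2
      have hG0 : G x = 0 := by linarith
      apply hne x hx
      simp only [hF] at h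
      simp only [hG] at hG0
      have e1 : (a ^ 2 + b ^ 2) * (x.1 - v.1) = 0 := by linear_combination -a * h - b * hG0
      have e2 : (a ^ 2 + b ^ 2) * (x.2 - v.2) = 0 := by linear_combination -b * h + a * hG0
      have e3 := (mul_eq_zero.mp e1).resolve_left hab.ne'
      have e4 := (mul_eq_zero.mp e2).resolve_left hab.ne'
      exact Prod.ext (by linarith) (by linarith)
    · exact h
  -- orientation via slopes
  have hori : ∀ p q, 0 < F p → 0 < F q →
      (a ^ 2 + b ^ 2) * ori v p q = F p * F q * (th q - th p) := by
    intro p q hp hq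
    simp only [hth]
    field_simp
    simp only [hF, hG, ori]; ring
  have hpos : ∀ p q, 0 < F p → 0 < F q → th p < th q → 0 < ori v p q := by
    intro p q hp hq h
    have := hori p q hp hq
    have h2 : 0 < F p * F q * (th q - th p) := mul_pos (mul_pos hp hq) (by linarith)
    rw [← this] at h2
    exact (mul_pos_iff_of_pos_left hab).1 h2
  have hthne : ∀ x ∈ I, ∀ w ∈ W, th x ≠ th w := by
    intro x hx w hw h
    have := hori x w (hFI x hx) (hFW w hw)
    rw [h, sub_self, mul_zero] at this
    have h3 := (mul_eq_zero.mp this).resolve_left hab.ne'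
    have hw' := Finset.mem_erase.1 hw
    exact ori_ne_of_genPos hS (hVS hv) (hIS hx) (hVS hw'.2) (hne x hx).symm hw'.1.symm
      (fun h => hdisj x hx (h ▸ hw'.2)) h3
  -- pigeonhole
  let A : Pt → Finset Pt := fun x => W.filter (fun w => th x < th w)
  have hA1 : ∀ x ∈ I, wM ∈ A x := by
    intro x hx
    refine Finset.mem_filter.2 ⟨hwM, lt_of_le_of_ne ?_ (hthne x hx _ hwM)⟩
    simp only [hth] at *
    rw [div_le_iff₀ (hFI x hx)]
    exact hupper _ hwM' x hx
  have hA2 : ∀ x ∈ I, wm ∉ A x := by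
    intro x hx h
    have h1 := (Finset.mem_filter.1 h).2
    have h2 : th wm ≤ th x := by
      simp only [hth] at *
      rw [le_div_iff₀ (hFI x hx)]
      exact hlower _ hwm' x hx
    linarith
  have hWcard : W.card + 1 = V.card := Finset.card_erase_add_one hv
  have hmaps : ∀ x ∈ I, (A x).card ∈ Finset.Icc 1 (W.card - 1) := by
    intro x hx
    have h1 : 0 < (A x).card := Finset.card_pos.2 ⟨_, hA1 x hx⟩
    have h2 : (A x).card < W.card := Finset.card_lt_card
      (Finset.ssubset_iff_subset_ne.2 ⟨Finset.filter_subset _ _, fun h => hA2 x hx (h ▸ hwm)⟩)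
    rw [Finset.mem_Icc]; omega
  have hlt : (Finset.Icc 1 (W.card - 1)).card < I.card := by
    have : 0 < W.card := Finset.card_pos.2 hWne
    rw [Nat.card_Icc]; omega
  obtain ⟨x', hx', y', hy', hxy', hAc'⟩ := Finset.exists_ne_map_eq_of_card_lt_of_maps_to hlt hmaps
  have hwlog : ∃ x ∈ I, ∃ y ∈ I, x ≠ y ∧ (A x).card = (A y).card ∧ th x ≤ th y := by
    rcases le_total (th x') (th y') with h | h
    · exact ⟨x', hx', y', hy', hxy', hAc', h⟩
    · exact ⟨y', hy', x', hx', hxy'.symm, hAc'.symm, h⟩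
  obtain ⟨x, hx, y, hy, hxy, hAc, hle⟩ := hwlog
  have hAeq : A y = A x := by
    apply Finset.eq_of_subset_of_card_le
    · intro w hw
      have := Finset.mem_filter.1 hw
      exact Finset.mem_filter.2 ⟨this.1, lt_of_le_of_lt hle this.2⟩
    · exact hAc.le
  obtain ⟨w, hw, hw'⟩ := (A x).exists_min_image th ⟨_, hA1 x hx⟩
  obtain ⟨u, hu, hu'⟩ := (W \ A x).exists_max_image th
    ⟨wm, Finset.mem_sdiff.2 ⟨hwm, hA2 x hx⟩⟩
  have hwW := (Finset.mem_filter.1 hw).1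
  have huW := (Finset.mem_sdiff.1 hu).1
  have hlo : ∀ z ∈ I, A z = A x → th u < th z ∧ th z < th w := by
    intro z hz hzA
    constructor
    · refine lt_of_le_of_ne ?_ (hthne z hz u huW).symm
      by_contra h
      exact (Finset.mem_sdiff.1 hu).2 (hzA ▸ Finset.mem_filter.2 ⟨huW, not_le.1 h⟩)
    · rw [← hzA] at hw
      exact (Finset.mem_filter.1 hw).2
  have hwV := (Finset.mem_erase.1 hwW)
  have huV := (Finset.mem_erase.1 huW)
  have huw : th u < th w := (hlo x hx rfl).1.trans (hlo x hx rfl).2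
  have huwne : u ≠ w := fun h => by rw [h] at huw; exact lt_irrefl _ huw
  have hvuw : 0 < ori v u w := hpos u w (hFW u huW) (hFW w hwW) huw
  have hside : ∀ z ∈ (V : Set Pt), 0 ≤ ori u w z := by
    intro z hz
    by_contra hneg
    have hneg := not_le.1 hneg
    have hzv : z ≠ v := by rintro rfl; rw [← ori_rot] at hneg; linarith
    have hzu : z ≠ u := by rintro rfl; simp [ori] at hneg
    have hzw : z ≠ w := by
      rintro rfl
      have : ori u z z = 0 := by unfold ori; ring
      linarith
    have hzW : z ∈ W := Finset.mem_erase.2 ⟨hzv, hz⟩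
    by_cases hzA : z ∈ A x
    · have h1 := hw' z hzA
      have h1' : 0 ≤ ori v w z := by
        have h5 := hori w z (hFW w hwW) (hFW z hzW)
        have h6 : 0 ≤ F w * F z * (th z - th w) :=
          mul_nonneg (mul_pos (hFW w hwW) (hFW z hzW)).le (by linarith)
        rw [← h5] at h6
        exact nonneg_of_mul_nonneg_right h6 hab
      have h2 := hpos u z (hFW u huW) (hFW z hzW) (huw.trans_le h1)
      have : w ∈ convexHull ℝ ({v, u, z} : Set Pt) := by
        refine mem_hull_triangle ?_ h1' hvuw.le h2
        rw [ori_swap]; linarith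
      refine hV w hwV.2 (convexHull_mono ?_ this)
      intro t ht
      simp only [Set.mem_insert_iff, Set.mem_singleton_iff] at ht
      rcases ht with rfl | rfl | rfl
      · exact ⟨hv, hwV.1.symm⟩
      · exact ⟨huV.2, huwne⟩
      · exact ⟨hz, hzw⟩
    · have h1 := hu' z (Finset.mem_sdiff.2 ⟨hzW, hzA⟩)
      have h1' : 0 ≤ ori v z u := by
        have h5 := hori z u (hFW z hzW) (hFW u huW)
        have h6 : 0 ≤ F z * F u * (th u - th z) :=
          mul_nonneg (mul_pos (hFW z hzW) (hFW u huW)).le (by linarith)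
        rw [← h5] at h6
        exact nonneg_of_mul_nonneg_right h6 hab
      have h2 := hpos z w (hFW z hzW) (hFW w hwW) (h1.trans_lt huw)
      have : u ∈ convexHull ℝ ({v, z, w} : Set Pt) := by
        refine mem_hull_triangle ?_ hvuw.le h1' h2
        rw [ori_swap2]; linarith
      refine hV u huV.2 (convexHull_mono ?_ this)
      intro t ht
      simp only [Set.mem_insert_iff, Set.mem_singleton_iff] at ht
      rcases ht with rfl | rfl | rfl
      · exact ⟨hv, huV.1.symm⟩
      · exact ⟨hz, hzu⟩
      · exact ⟨hwV.2, huwne.symm⟩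
  have hin : ∀ z ∈ I, A z = A x → 0 < ori v u z ∧ 0 < ori u w z ∧ 0 < ori w v z := by
    intro z hz hzA
    obtain ⟨h1, h2⟩ := hlo z hz hzA
    refine ⟨hpos u z (hFW u huW) (hFI z hz) h1, ?_, ?_⟩
    · refine lt_of_le_of_ne (hull_ori hside (hI z hz)) (Ne.symm ?_)
      exact ori_ne_of_genPos hS (hVS huV.2) (hVS hwV.2) (hIS hz) huwne
        (fun h => hdisj z hz (h ▸ huV.2)) (fun h => hdisj z hz (h ▸ hwV.2))
    · rw [ori_rot]
      exact hpos z w (hFI z hz) (hFW w hwW) h2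
  obtain ⟨x1, x2, x3⟩ := hin x hx rfl
  obtain ⟨y1, y2, y3⟩ := hin y hy hAeq
  exact pentagon_of_two hS (hVS hv) (hVS huV.2) (hVS hwV.2) (hIS hx) (hIS hy) hxy
    y1 y2 y3 x1 x2 x3

lemma upper_bound (k : ℕ) (hk : 3 ≤ k) (S : Set Pt) (hfin : S.Finite) (hS : GenPos S)
    (hcard : 2 * k - 3 ≤ S.ncard) :
    (∃ H ⊆ S, H.ncard = k ∧ ConvexPos H) ∨
      (∃ v : ZMod 5 → Pt, Set.range v ⊆ S ∧ IsPseudoTriangle 5 v) := by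
  classical
  obtain ⟨T, rfl⟩ := hfin.exists_finset_coe
  rw [Set.ncard_coe_finset] at hcard
  let P : Finset (Finset Pt) := T.powerset.filter (fun V : Finset Pt => (T : Set Pt) ⊆ convexHull ℝ (V : Set Pt))
  have hP : P.Nonempty := ⟨T, Finset.mem_filter.2 ⟨Finset.mem_powerset_self T,
    subset_convexHull ℝ _⟩⟩
  obtain ⟨V, hVP, hVmin⟩ := P.exists_min_image Finset.card hP
  obtain ⟨hVT, hVhull⟩ := Finset.mem_filter.1 hVP
  rw [Finset.mem_powerset] at hVT
  have hconv : ConvexPos (V : Set Pt) := by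
    intro p hp hmem
    have hp' : p ∈ V := hp
    have h1 : V.erase p ∈ P := by
      refine Finset.mem_filter.2 ⟨Finset.mem_powerset.2 ((Finset.erase_subset _ _).trans hVT), ?_⟩
      refine hVhull.trans (convexHull_min ?_ (convex_convexHull _ _))
      intro z hz
      rw [Finset.coe_erase]
      by_cases h : z = p
      · rw [h]; exact hmem
      · exact subset_convexHull ℝ _ ⟨hz, h⟩
    have h2 := hVmin _ h1
    have h3 := Finset.card_erase_lt_of_mem hp'
    omega
  by_cases hh : k ≤ V.card
  · left
    obtain ⟨H, hHV, hHc⟩ := Finset.exists_subset_card_eq hh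
    refine ⟨H, fun z hz => hVT (hHV hz), by rw [Set.ncard_coe_finset, hHc], ?_⟩
    intro p hp hmem
    refine hconv p (hHV hp) (convexHull_mono ?_ hmem)
    exact Set.sdiff_subset_sdiff_left (fun z hz => hHV hz)
  · right
    have hc : (T \ V).card + V.card = T.card := Finset.card_sdiff_add_card_eq_card hVT
    refine two_in_triangle hS V (T \ V) (fun z hz => hVT hz) (fun z hz => ?_) (fun z hz => ?_)
      hconv (fun z hz => ?_) ?_ ?_
    · exact (Finset.mem_sdiff.1 hz).1
    · exact (Finset.mem_sdiff.1 hz).2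
    · exact hVhull (Finset.mem_sdiff.1 hz).1
    · rw [← Finset.card_pos]; omega
    · omega

/-- The extremal configuration: doubled points on a parabola. -/
def fpt (n : ℕ) : Pt := (((n / 2 : ℕ) : ℝ), ((n / 2 : ℕ) : ℝ) ^ 2 + ((n % 2 : ℕ) : ℝ) / 2)

lemma fpt_pos {a b c : ℕ} (hab : a < b) (hbc : b < c) (h : a / 2 ≠ b / 2) :
    0 < ori (fpt a) (fpt b) (fpt c) := by
  have h1 : a / 2 + 1 ≤ b / 2 := by omega
  by_cases h2 : b / 2 = c / 2
  · have hb : b % 2 = 0 := by omega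
    have hc : c % 2 = 1 := by omega
    have h1' : ((a / 2 : ℕ) : ℝ) + 1 ≤ ((b / 2 : ℕ) : ℝ) := by exact_mod_cast h1
    simp only [ori, fpt, ← h2, hb, hc]
    push_cast at *
    nlinarith
  · have h3 : b / 2 + 1 ≤ c / 2 := by omega
    have h1' : ((a / 2 : ℕ) : ℝ) + 1 ≤ ((b / 2 : ℕ) : ℝ) := by exact_mod_cast h1
    have h3' : ((b / 2 : ℕ) : ℝ) + 1 ≤ ((c / 2 : ℕ) : ℝ) := by exact_mod_cast h3
    have ha : (0 : ℝ) ≤ ((a % 2 : ℕ) : ℝ) := by positivity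
    have hc : (0 : ℝ) ≤ ((c % 2 : ℕ) : ℝ) := by positivity
    have hb : ((b % 2 : ℕ) : ℝ) ≤ 1 := by
      have : b % 2 ≤ 1 := by omega
      exact_mod_cast this
    simp only [ori, fpt]
    generalize ((a / 2 : ℕ) : ℝ) = x at *
    generalize ((b / 2 : ℕ) : ℝ) = y at *
    generalize ((c / 2 : ℕ) : ℝ) = z at *
    generalize ((a % 2 : ℕ) : ℝ) = da at *
    generalize ((b % 2 : ℕ) : ℝ) = db at *
    generalize ((c % 2 : ℕ) : ℝ) = dc at *
    have e : (y - x) * (z ^ 2 + dc / 2 - (x ^ 2 + da / 2)) - (y ^ 2 + db / 2 - (x ^ 2 + da / 2)) * (z - x)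
      = (z - x) * ((y - x) * (z - y) - db / 2) + dc / 2 * (y - x) + da / 2 * (z - y) := by ring
    rw [e]
    have p1 : 1 ≤ (y - x) * (z - y) := by nlinarith
    have p2 : 0 < (z - x) * ((y - x) * (z - y) - db / 2) := mul_pos (by linarith) (by linarith)
    have p3 : 0 ≤ dc / 2 * (y - x) := mul_nonneg (by linarith) (by linarith)
    have p4 : 0 ≤ da / 2 * (z - y) := mul_nonneg (by linarith) (by linarith)
    linarith

lemma fpt_neg {a b c : ℕ} (hab : a < b) (hbc : b < c) (h : a / 2 = b / 2) :
    ori (fpt a) (fpt b) (fpt c) < 0 := by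
  have h1 : b / 2 + 1 ≤ c / 2 := by omega
  have ha : a % 2 = 0 := by omega
  have hb : b % 2 = 1 := by omega
  have h1' : ((b / 2 : ℕ) : ℝ) + 1 ≤ ((c / 2 : ℕ) : ℝ) := by exact_mod_cast h1
  simp only [ori, fpt, h, ha, hb]
  push_cast at *
  nlinarith

lemma fpt_inj : Function.Injective fpt := by
  intro a b h
  simp only [fpt, Prod.mk.injEq] at h
  obtain ⟨h1, h2⟩ := h
  rw [h1] at h2
  have h3 : ((a % 2 : ℕ) : ℝ) = ((b % 2 : ℕ) : ℝ) := by linarith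
  have h4 : a / 2 = b / 2 := by exact_mod_cast h1
  have h5 : a % 2 = b % 2 := by exact_mod_cast h3
  omega

/-- Sign of a sorted triple. -/
def bs (d : Fin 5 → Bool) (i j : Fin 5) : Bool := !(j == i + 1 && d i)

/-- Sign of an arbitrary triple. -/
def sg (d : Fin 5 → Bool) (i j k : Fin 5) : Bool :=
  if i < j then (if j < k then bs d i j else if i < k then !bs d i k else bs d k i)
  else (if i < k then !bs d j i else if j < k then bs d j k else !bs d k j)

/-- Crossing test. -/
def crs (d : Fin 5 → Bool) (i j k l : Fin 5) : Bool :=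
  (sg d i j k != sg d i j l) && (sg d k l i != sg d k l j)

/-- The combinatorial check. -/
def chk (d : Fin 5 → Bool) (a b c e f : Fin 5) : Bool :=
  crs d a b c e || crs d a b e f || crs d b c e f || crs d b c f a || crs d c e f a ||
  (let n := (sg d f a b).toNat + (sg d a b c).toNat + (sg d b c e).toNat + (sg d c e f).toNat
      + (sg d e f a).toNat
   n != 2 && n != 3)

set_option synthInstance.maxHeartbeats 400000 in
set_option synthInstance.maxSize 10000 in
lemma chk_all : ∀ d0 d1 d2 d3 : Bool, (d0 && d1) = false → (d1 && d2) = false →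
    (d2 && d3) = false → ∀ a b : Fin 5, a ≠ b → ∀ c : Fin 5, c ≠ a → c ≠ b → ∀ e : Fin 5,
    e ≠ a → e ≠ b → e ≠ c → ∀ f : Fin 5, f ≠ a → f ≠ b → f ≠ c → f ≠ e →
    chk ![d0, d1, d2, d3, false] a b c e f = true := by
  decide +kernel

lemma ori_ne_fpt {a b c : ℕ} (h1 : a ≠ b) (h2 : a ≠ c) (h3 : b ≠ c) :
    ori (fpt a) (fpt b) (fpt c) ≠ 0 := by
  have key : ∀ x y z : ℕ, x < y → y < z → ori (fpt x) (fpt y) (fpt z) ≠ 0 := by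
    intro x y z h h'
    by_cases hd : x / 2 = y / 2
    · exact (fpt_neg h h' hd).ne
    · exact (fpt_pos h h' hd).ne'
  rcases lt_or_gt_of_ne h1 with h1 | h1 <;> rcases lt_or_gt_of_ne h2 with h2 | h2 <;>
    rcases lt_or_gt_of_ne h3 with h3 | h3
  · exact key _ _ _ h1 h3
  · rw [ori_swap2]; exact neg_ne_zero.2 (key _ _ _ h2 h3)
  · omega
  · rw [ori_rot, ori_rot]; exact key _ _ _ h2 h1
  · rw [ori_swap]; exact neg_ne_zero.2 (key _ _ _ h1 h2)
  · omega
  · rw [ori_rot]; exact key _ _ _ h3 h2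
  · rw [ori_swap, ori_rot, ori_rot]; exact neg_ne_zero.2 (key _ _ _ h3 h1)

lemma sg_spec (p : Fin 5 → ℕ) (hp : StrictMono p) (d : Fin 5 → Bool)
    (hd : ∀ i j : Fin 5, i < j → (bs d i j = true ↔ p i / 2 ≠ p j / 2)) (i j k : Fin 5)
    (h1 : i ≠ j) (h2 : i ≠ k) (h3 : j ≠ k) :
    sg d i j k = true ↔ 0 < ori (fpt (p i)) (fpt (p j)) (fpt (p k)) := by
  have key : ∀ x y z : Fin 5, x < y → y < z →
      (bs d x y = true ↔ 0 < ori (fpt (p x)) (fpt (p y)) (fpt (p z))) := by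
    intro x y z h h'
    rw [hd x y h]
    constructor
    · intro hh; exact fpt_pos (hp h) (hp h') hh
    · intro hh he; exact absurd (fpt_neg (hp h) (hp h') he) (not_lt.2 hh.le)
  have key2 : ∀ x y z : Fin 5, x < y → y < z →
      ((!bs d x y) = true ↔ 0 < - ori (fpt (p x)) (fpt (p y)) (fpt (p z))) := by
    intro x y z h h'
    have h4 := key x y z h h'
    have h5 : ori (fpt (p x)) (fpt (p y)) (fpt (p z)) ≠ 0 :=
      ori_ne_fpt (hp h).ne (hp (h.trans h')).ne (hp h').ne
    rw [neg_pos, Bool.not_eq_true', ← Bool.not_eq_true, h4, not_lt]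
    exact ⟨fun h => lt_of_le_of_ne h h5, le_of_lt⟩
  unfold sg
  rcases lt_or_gt_of_ne h1 with h1 | h1 <;> rcases lt_or_gt_of_ne h2 with h2 | h2 <;>
    rcases lt_or_gt_of_ne h3 with h3 | h3
  · rw [if_pos h1, if_pos h3]; exact key _ _ _ h1 h3
  · rw [if_pos h1, if_neg (not_lt.2 h3.le), if_pos h2, ori_swap2]; exact key2 _ _ _ h2 h3
  · omega
  · rw [if_pos h1, if_neg (not_lt.2 h3.le), if_neg (not_lt.2 h2.le), ori_rot, ori_rot]
    exact key _ _ _ h2 h1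
  · rw [if_neg (not_lt.2 h1.le), if_pos h2, ori_swap]; exact key2 _ _ _ h1 h2
  · omega
  · rw [if_neg (not_lt.2 h1.le), if_neg (not_lt.2 h2.le), if_pos h3, ori_rot]
    exact key _ _ _ h3 h2
  · rw [if_neg (not_lt.2 h1.le), if_neg (not_lt.2 h2.le), if_neg (not_lt.2 h3.le),
      ori_swap, ori_rot, ori_rot]
    exact key2 _ _ _ h3 h1

lemma no_pseudo (v : ZMod 5 → Pt) (hv : Set.range v ⊆ Set.range fpt)
    (hps : IsPseudoTriangle 5 v) : False := by
  classical
  obtain ⟨hsimple, -, hcount⟩ := hps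
  have hex : ∀ i, ∃ n, fpt n = v i := fun i => hv ⟨i, rfl⟩
  choose m hm using hex
  have hminj : Function.Injective m := by
    intro i j h
    apply hsimple.inj
    rw [← hm, ← hm, h]
  let M : Finset ℕ := Finset.univ.image m
  have hM : M.card = 5 := by
    rw [Finset.card_image_of_injective _ hminj]; rfl
  let p : Fin 5 → ℕ := M.orderEmbOfFin hM
  have hp : StrictMono p := (M.orderEmbOfFin hM).strictMono
  have hrange : ∀ i, ∃ t, p t = m i := by
    intro i
    have : m i ∈ Set.range (M.orderEmbOfFin hM) := by
      rw [Finset.range_orderEmbOfFin]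
      simp [M]
    exact this
  choose s hs using hrange
  have hsinj : ∀ i j, i ≠ j → s i ≠ s j := by
    intro i j h h'
    exact h (hminj (by rw [← hs, ← hs, h']))
  have hvp : ∀ i, v i = fpt (p (s i)) := fun i => by rw [hs, hm]
  let d : Fin 5 → Bool := ![decide (p 0 / 2 = p 1 / 2), decide (p 1 / 2 = p 2 / 2),
    decide (p 2 / 2 = p 3 / 2), decide (p 3 / 2 = p 4 / 2), false]
  have p01 : p 0 < p 1 := hp (by decide)
  have p12 : p 1 < p 2 := hp (by decide)
  have p23 : p 2 < p 3 := hp (by decide)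
  have p34 : p 3 < p 4 := hp (by decide)
  have hd : ∀ i j : Fin 5, i < j → (bs d i j = true ↔ p i / 2 ≠ p j / 2) := by
    intro i j hij
    fin_cases i <;> fin_cases j <;> first
      | exact absurd hij (by decide)
      | (simp [bs, d]; done)
      | (simp [bs, d]; omega)
  have hsg : ∀ i j k : ZMod 5, i ≠ j → i ≠ k → j ≠ k →
      (sg d (s i) (s j) (s k) = true ↔ 0 < ori (v i) (v j) (v k)) := by
    intro i j k h1 h2 h3
    rw [hvp, hvp, hvp]
    exact sg_spec p hp d hd _ _ _ (hsinj _ _ h1) (hsinj _ _ h2) (hsinj _ _ h3)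
  have hne : ∀ i j k : ZMod 5, i ≠ j → i ≠ k → j ≠ k → ori (v i) (v j) (v k) ≠ 0 := by
    intro i j k h1 h2 h3
    rw [← hm, ← hm, ← hm]
    exact ori_ne_fpt (hminj.ne h1) (hminj.ne h2) (hminj.ne h3)
  have hsgn : ∀ i j k l : ZMod 5, i ≠ j → i ≠ k → j ≠ k → i ≠ l → j ≠ l →
      sg d (s i) (s j) (s k) ≠ sg d (s i) (s j) (s l) →
      ori (v i) (v j) (v k) * ori (v i) (v j) (v l) < 0 := by
    intro i j k l h1 h2 h3 h4 h5 h
    have a1 := hsg i j k h1 h2 h3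
    have a2 := hsg i j l h1 h4 h5
    have b1 := hne i j k h1 h2 h3
    have b2 := hne i j l h1 h4 h5
    rcases lt_or_gt_of_ne b1 with c1 | c1 <;> rcases lt_or_gt_of_ne b2 with c2 | c2
    · exfalso; apply h
      rw [Bool.eq_iff_iff, a1, a2]
      exact iff_of_false (not_lt.2 c1.le) (not_lt.2 c2.le)
    · exact mul_neg_of_neg_of_pos c1 c2
    · exact mul_neg_of_pos_of_neg c1 c2
    · exfalso; apply h
      rw [Bool.eq_iff_iff, a1, a2]
      exact iff_of_true c1 c2
  have hcrs : ∀ i k : ZMod 5, i ≠ k → i ≠ k + 1 → k ≠ i + 1 →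
      crs d (s i) (s (i + 1)) (s k) (s (k + 1)) = false := by
    intro i k h1 h2 h3
    have n1 : i ≠ i + 1 := by clear h1 h2 h3; revert i; decide
    have n2 : k ≠ k + 1 := by clear h1 h2 h3; revert k; decide
    have n3 : i + 1 ≠ k + 1 := fun h => h1 (add_right_cancel h)
    rw [← Bool.not_eq_true]
    intro hc
    simp only [crs, Bool.and_eq_true, bne_iff_ne] at hc
    have q1 := hsgn i (i + 1) k (k + 1) n1 h1 h3.symm h2 n3 hc.1
    have q2 := hsgn k (k + 1) i (i + 1) n2 h1.symm h2.symm h3 n3.symm hc.2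
    obtain ⟨z, hz⟩ := seg_cross q1 q2
    rw [hsimple.nonadj i k h1 h2 h3] at hz
    exact hz
  have hchk := chk_all (decide (p 0 / 2 = p 1 / 2)) (decide (p 1 / 2 = p 2 / 2))
    (decide (p 2 / 2 = p 3 / 2)) (decide (p 3 / 2 = p 4 / 2))
    (by simp; omega) (by simp; omega) (by simp; omega)
    (s 0) (s 1) (hsinj _ _ (by decide)) (s 2) (hsinj _ _ (by decide)) (hsinj _ _ (by decide))
    (s 3) (hsinj _ _ (by decide)) (hsinj _ _ (by decide)) (hsinj _ _ (by decide))
    (s 4) (hsinj _ _ (by decide)) (hsinj _ _ (by decide)) (hsinj _ _ (by decide))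
    (hsinj _ _ (by decide))
  change chk d (s 0) (s 1) (s 2) (s 3) (s 4) = true at hchk
  have c1 : crs d (s 0) (s 1) (s 2) (s 3) = false :=
    hcrs 0 2 (by decide) (by decide) (by decide)
  have c2 : crs d (s 0) (s 1) (s 3) (s 4) = false :=
    hcrs 0 3 (by decide) (by decide) (by decide)
  have c3 : crs d (s 1) (s 2) (s 3) (s 4) = false :=
    hcrs 1 3 (by decide) (by decide) (by decide)
  have c4 : crs d (s 1) (s 2) (s 4) (s 0) = false :=
    hcrs 1 4 (by decide) (by decide) (by decide)
  have c5 : crs d (s 2) (s 3) (s 4) (s 0) = false :=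
    hcrs 2 4 (by decide) (by decide) (by decide)
  simp only [chk, c1, c2, c3, c4, c5, Bool.false_or, Bool.and_eq_true, bne_iff_ne] at hchk
  -- the turns
  let t : ZMod 5 → Bool := fun i => sg d (s (i - 1)) (s i) (s (i + 1))
  have ht : ∀ i, t i = true ↔ 0 < vtxCross 5 v i := by
    intro i
    rw [vtxCross_eq]
    exact hsg _ _ _ (by revert i; decide) (by revert i; decide) (by revert i; decide)
  have htne : ∀ i, vtxCross 5 v i ≠ 0 := by
    intro i
    rw [vtxCross_eq]
    exact hne _ _ _ (by revert i; decide) (by revert i; decide) (by revert i; decide)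
  have hsum : (Finset.univ.filter (fun i => t i = true)).card =
      (t 0).toNat + (t 1).toNat + (t 2).toNat + (t 3).toNat + (t 4).toNat := by
    rw [Finset.card_filter]
    have := Fin.sum_univ_five (fun i : ZMod 5 => if t i = true then 1 else 0)
    refine this.trans ?_
    have e : ∀ b : Bool, (if b = true then 1 else 0) = b.toNat := by decide
    simp only [e]
    rfl
  have hn : (Finset.univ.filter (fun i => t i = true)).card ≠ 2 ∧
      (Finset.univ.filter (fun i => t i = true)).card ≠ 3 := by
    rw [hsum]; exact hchk
  rcases lt_trichotomy (signedArea 5 v) 0 with ha | ha | ha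
  · have : {i : ZMod 5 | IsConvexVtx 5 v i} =
        ((Finset.univ.filter (fun i => t i = true))ᶜ : Finset (ZMod 5)) := by
      ext i
      rw [Finset.mem_coe, Finset.mem_compl, Finset.mem_filter]
      change 0 < vtxCross 5 v i * signedArea 5 v ↔ _
      rw [ht i]
      constructor
      · intro h h'
        nlinarith [h'.2]
      · intro h
        have h2 : ¬ 0 < vtxCross 5 v i := fun h' => h ⟨Finset.mem_univ _, h'⟩
        exact mul_pos_of_neg_of_neg (lt_of_le_of_ne (not_lt.1 h2) (htne i)) ha
    rw [this, Set.ncard_coe_finset, Finset.card_compl] at hcount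
    have h5 : Fintype.card (ZMod 5) = 5 := rfl
    rw [h5] at hcount
    omega
  · have : {i : ZMod 5 | IsConvexVtx 5 v i} = ∅ := by
      ext i
      change 0 < vtxCross 5 v i * signedArea 5 v ↔ _
      simp [ha]
    rw [this] at hcount
    simp at hcount
  · have : {i : ZMod 5 | IsConvexVtx 5 v i} =
        ((Finset.univ.filter (fun i => t i = true)) : Finset (ZMod 5)) := by
      ext i
      rw [Finset.mem_coe, Finset.mem_filter]
      change 0 < vtxCross 5 v i * signedArea 5 v ↔ _
      rw [ht i, mul_pos_iff_of_pos_right ha]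
      simp
    rw [this, Set.ncard_coe_finset] at hcount
    exact hn.2 hcount

lemma lower_convex (k : ℕ) (hk : 3 ≤ k) (J : Finset ℕ) (hJ : J ⊆ Finset.Icc 1 (2 * k - 4))
    (hcard : J.card = k) (hconv : ConvexPos (fpt '' (J : Set ℕ))) : False := by
  have hne : J.Nonempty := by rw [← Finset.card_pos]; omega
  have hamin := J.min'_mem hne
  have hcmax := J.max'_mem hne
  set a := J.min' hne with ha
  set c := J.max' hne with hc
  let K := (J.erase a).erase c
  have hK : k - 2 ≤ K.card := by
    have h1 := Finset.card_erase_of_mem hamin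
    have h2 := Finset.pred_card_le_card_erase (s := J.erase a) (a := c)
    simp only [K]; omega
  have hKmem : ∀ n ∈ K, n ∈ J ∧ a < n ∧ n < c := by
    intro n hn
    obtain ⟨h1, h2⟩ := Finset.mem_erase.1 hn
    obtain ⟨h3, h4⟩ := Finset.mem_erase.1 h2
    exact ⟨h4, lt_of_le_of_ne (J.min'_le n h4) h3.symm, lt_of_le_of_ne (J.le_max' n h4) h1⟩
  have ha1 := Finset.mem_Icc.1 (hJ hamin)
  have hc1 := Finset.mem_Icc.1 (hJ hcmax)
  have hmaps : ∀ n ∈ K, n / 2 ∈ Finset.Icc 1 (k - 3) := by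
    intro n hn
    have := hKmem n hn
    rw [Finset.mem_Icc]; omega
  have hlt : (Finset.Icc 1 (k - 3)).card < K.card := by
    rw [Nat.card_Icc]; omega
  obtain ⟨x', hx', y', hy', hxy', he'⟩ := Finset.exists_ne_map_eq_of_card_lt_of_maps_to hlt hmaps
  obtain ⟨x, hx, y, hy, hxy, he⟩ : ∃ x ∈ K, ∃ y ∈ K, x < y ∧ x / 2 = y / 2 := by
    rcases lt_or_gt_of_ne hxy' with h | h
    · exact ⟨x', hx', y', hy', h, he'⟩
    · exact ⟨y', hy', x', hx', h, he'.symm⟩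
  obtain ⟨hxJ, hax, hxc⟩ := hKmem x hx
  obtain ⟨hyJ, hay, hyc⟩ := hKmem y hy
  have hmem : fpt y ∈ convexHull ℝ ({fpt a, fpt x, fpt c} : Set Pt) := by
    refine mem_hull_triangle ?_ ?_ ?_ ?_
    · rw [ori_swap]; linarith [fpt_neg hxy hyc he]
    · exact (fpt_pos hay hyc (by omega)).le
    · exact (fpt_pos hax hxy (by omega)).le
    · exact fpt_pos hax hxc (by omega)
  refine hconv (fpt y) ⟨y, hyJ, rfl⟩ (convexHull_mono ?_ hmem)
  intro z hz
  simp only [Set.mem_insert_iff, Set.mem_singleton_iff] at hz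
  rcases hz with rfl | rfl | rfl
  · exact ⟨⟨a, hamin, rfl⟩, fun h => hay.ne (fpt_inj h)⟩
  · exact ⟨⟨x, hxJ, rfl⟩, fun h => hxy.ne (fpt_inj h)⟩
  · exact ⟨⟨c, hcmax, rfl⟩, fun h => hyc.ne' (fpt_inj h)⟩

lemma lower_bound (k : ℕ) (hk : 3 ≤ k) :
    ∃ S : Set Pt, S.Finite ∧ GenPos S ∧ S.ncard = 2 * k - 4 ∧
      ¬ (∃ H ⊆ S, H.ncard = k ∧ ConvexPos H) ∧
      ¬ (∃ v : ZMod 5 → Pt, Set.range v ⊆ S ∧ IsPseudoTriangle 5 v) := by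
  classical
  refine ⟨fpt '' ((Finset.Icc 1 (2 * k - 4) : Finset ℕ) : Set ℕ),
    (Finset.finite_toSet _).image _, ?_, ?_, ?_, ?_⟩
  · rintro _ ⟨a, -, rfl⟩ _ ⟨b, -, rfl⟩ _ ⟨c, -, rfl⟩ h1 h2 h3
    exact not_collinear_of_ori (ori_ne_fpt (fun h => h1 (h ▸ rfl)) (fun h => h2 (h ▸ rfl))
      (fun h => h3 (h ▸ rfl)))
  · rw [Set.ncard_image_of_injective _ fpt_inj, Set.ncard_coe_finset, Nat.card_Icc]
    omega
  · rintro ⟨H, hHS, hHc, hH⟩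
    obtain ⟨J, hJ, rfl⟩ := Set.subset_image_iff.1 hHS
    have hJfin : J.Finite := (Finset.finite_toSet _).subset hJ
    obtain ⟨J, rfl⟩ := hJfin.exists_finset_coe
    rw [Set.ncard_image_of_injective _ fpt_inj, Set.ncard_coe_finset] at hHc
    exact lower_convex k hk J (Finset.coe_subset.1 hJ) hHc hH
  · rintro ⟨v, hv, hps⟩
    exact no_pseudo v (hv.trans (Set.image_subset_range _ _)) hps

/-- `F(k,5) = 2k - 3`. -/
theorem statement_17 (k : ℕ) (hk : 3 ≤ k) :
    (∀ S : Set Pt, S.Finite → GenPos S → 2 * k - 3 ≤ S.ncard →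
      (∃ H ⊆ S, H.ncard = k ∧ ConvexPos H) ∨
      (∃ v : ZMod 5 → Pt, Set.range v ⊆ S ∧ IsPseudoTriangle 5 v)) ∧
    (∃ S : Set Pt, S.Finite ∧ GenPos S ∧ S.ncard = 2 * k - 4 ∧
      ¬ (∃ H ⊆ S, H.ncard = k ∧ ConvexPos H) ∧
      ¬ (∃ v : ZMod 5 → Pt, Set.range v ⊆ S ∧ IsPseudoTriangle 5 v)) := by
  exact ⟨fun S hf hS hc => upper_bound k hk S hf hS hc, lower_bound k hk⟩
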